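/- arXiv:2304.14172 — 3 statements merged into one kernel-verified Lean document; each statement's English description precedes it below -/
import Mathlib

section
/- Let G[X,Y] be a finite bipartite graph and k ≥ 1 an integer with k·|Y| even; suppose G has no partial parity (g,f)-factor with respect to W = X, where f(v) = 2 for v ∈ X, f(v) = k for v ∈ Y, g(v) = 0 for v ∈ X, g(v) = k for v ∈ Y, and let (A,B) be a biased barrier of G. If D is an odd component of G − (A ∪ B), then |V(D)| ≥ e_G(B,D). -/
noncomputable section

/-- `eCnt G S T` is the number of edges of `G` with one endpoint in `S` and the other in `T`
(intended for disjoint `S` and `T`). -/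
def eCnt {V : Type*} (G : SimpleGraph V) (S T : Set V) : ℕ :=
  Nat.card {p : V × V // p.1 ∈ S ∧ p.2 ∈ T ∧ G.Adj p.1 p.2}

/-- The degree of `v` in `G − A` (the induced subgraph on the complement of `A`). -/
def degDel {V : Type*} (G : SimpleGraph V) (A : Set V) (v : V) : ℕ :=
  (G.neighborSet v \ A).ncard

/-- The vertex set of a connected component of an induced subgraph, viewed inside the
ambient vertex set. -/
def compSupp {V : Type*} {G : SimpleGraph V} {s : Set V}
    (c : (G.induce s).ConnectedComponent) : Set V :=
  Subtype.val '' c.supp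

/-- A component `D` of `G − (A ∪ B)` is odd if `Σ_{v ∈ V(D)} f v + e_G(D,B)` is odd. -/
def IsOddComp {V : Type*} (G : SimpleGraph V) (f : V → ℤ) (A B : Set V)
    (c : (G.induce (A ∪ B)ᶜ).ConnectedComponent) : Prop :=
  Odd ((∑ᶠ v ∈ compSupp c, f v) + (eCnt G (compSupp c) B : ℤ))

/-- A component `D` of `G − (A ∪ B)` is even if `Σ_{v ∈ V(D)} f v + e_G(D,B)` is even. -/
def IsEvenComp {V : Type*} (G : SimpleGraph V) (f : V → ℤ) (A B : Set V)
    (c : (G.induce (A ∪ B)ᶜ).ConnectedComponent) : Prop :=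
  Even ((∑ᶠ v ∈ compSupp c, f v) + (eCnt G (compSupp c) B : ℤ))

/-- `h_W(A,B)`: the number of components `D` of `G − (A ∪ B)` such that `g v = f v` for all
`v ∈ V(D) \ W` and `Σ_{v ∈ V(D)} f v + e_G(D,B) ≡ 1 (mod 2)`. -/
def hWnum {V : Type*} (G : SimpleGraph V) (W : Set V) (g f : V → ℤ) (A B : Set V) : ℕ :=
  Nat.card {c : (G.induce (A ∪ B)ᶜ).ConnectedComponent //
    (∀ v ∈ compSupp c \ W, g v = f v) ∧ IsOddComp G f A B c}

/-- `δ_G(A,B) = Σ_{v∈A} f v − Σ_{v∈B} g v + Σ_{v∈B} d_{G−A}(v) − h_W(A,B)`. -/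
def deltaG {V : Type*} (G : SimpleGraph V) (W : Set V) (g f : V → ℤ) (A B : Set V) : ℤ :=
  (∑ᶠ v ∈ A, f v) - (∑ᶠ v ∈ B, g v) + (∑ᶠ v ∈ B, (degDel G A v : ℤ)) -
    (hWnum G W g f A B : ℤ)

/-- `F` is a partial parity `(g,f)`-factor of `G` with respect to `W`: a spanning subgraph with
`g v ≤ d_F v ≤ f v` for all `v` and `d_F v ≡ g v ≡ f v (mod 2)` for `v ∈ W`. -/
def IsPPFactor {V : Type*} (G F : SimpleGraph V) (W : Set V) (g f : V → ℤ) : Prop :=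
  F ≤ G ∧
  (∀ v : V, g v ≤ ((F.neighborSet v).ncard : ℤ) ∧ ((F.neighborSet v).ncard : ℤ) ≤ f v) ∧
  (∀ v ∈ W, Int.ModEq 2 ((F.neighborSet v).ncard : ℤ) (g v) ∧
    Int.ModEq 2 ((F.neighborSet v).ncard : ℤ) (f v))

/-- `(A,B)` is a barrier: a pair of disjoint vertex sets with `δ_G(A,B) < 0`. -/
def IsBarrier {V : Type*} (G : SimpleGraph V) (W : Set V) (g f : V → ℤ) (A B : Set V) : Prop :=
  Disjoint A B ∧ deltaG G W g f A B < 0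

/-- `(A,B)` is a biased barrier: among all barriers, `δ_G(A,B)` is minimum; subject to that,
`|B|` is minimum; subject to that, `|A|` is maximum. -/
def IsBiasedBarrier {V : Type*} (G : SimpleGraph V) (W : Set V) (g f : V → ℤ)
    (A B : Set V) : Prop :=
  IsBarrier G W g f A B ∧
  (∀ A' B' : Set V, IsBarrier G W g f A' B' → deltaG G W g f A B ≤ deltaG G W g f A' B') ∧
  (∀ A' B' : Set V, IsBarrier G W g f A' B' →
    deltaG G W g f A' B' = deltaG G W g f A B → B.ncard ≤ B'.ncard) ∧
  (∀ A' B' : Set V, IsBarrier G W g f A' B' →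
    deltaG G W g f A' B' = deltaG G W g f A B → B'.ncard = B.ncard → A'.ncard ≤ A.ncard)

/-- The function `f` of the `(2,k)`-factor setting: `f = 2` on `X` and `f = k` on `Y`. -/
def fB (X Y : Type*) (k : ℕ) : X ⊕ Y → ℤ := Sum.elim (fun _ => 2) (fun _ => (k : ℤ))

/-- The function `g` of the `(2,k)`-factor setting: `g = 0` on `X` and `g = k` on `Y`. -/
def gB (X Y : Type*) (k : ℕ) : X ⊕ Y → ℤ := Sum.elim (fun _ => 0) (fun _ => (k : ℤ))

section CountingEdges

variable {V : Type*}

theorem eCnt_comm (G : SimpleGraph V) (S T : Set V) : eCnt G S T = eCnt G T S :=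
  Nat.card_congr
    { toFun := fun p => ⟨p.1.swap, p.2.2.1, p.2.1, p.2.2.2.symm⟩
      invFun := fun p => ⟨p.1.swap, p.2.2.1, p.2.1, p.2.2.2.symm⟩
      left_inv := fun _ => rfl
      right_inv := fun _ => rfl }

theorem eCnt_eq_finsum [Finite V] (G : SimpleGraph V) (S T : Set V) :
    eCnt G S T = ∑ᶠ v ∈ S, (G.neighborSet v ∩ T).ncard := by
  classical
  have := Fintype.ofFinite S
  have e : {p : V × V // p.1 ∈ S ∧ p.2 ∈ T ∧ G.Adj p.1 p.2} ≃
      Σ v : S, ↥(G.neighborSet v.1 ∩ T) :=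
    { toFun := fun p => ⟨⟨p.1.1, p.2.1⟩, ⟨p.1.2, p.2.2.2, p.2.2.1⟩⟩
      invFun := fun q => ⟨(q.1.1, q.2.1), q.1.2, q.2.2.2, q.2.2.1⟩
      left_inv := fun _ => rfl
      right_inv := fun _ => rfl }
  rw [eCnt, Nat.card_congr e, Nat.card_sigma, ← finsum_set_coe_eq_finsum_mem,
    finsum_eq_sum_of_fintype]
  rfl

theorem eCnt_sdiff_singleton_right (G : SimpleGraph V) {S T : Set V} {v : V}
    (h : ∀ u ∈ S, ¬ G.Adj u v) : eCnt G S (T \ {v}) = eCnt G S T := by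
  refine Nat.card_congr (Equiv.subtypeEquivRight ?_)
  rintro ⟨a, b⟩
  constructor
  · rintro ⟨ha, hb, hab⟩
    exact ⟨ha, hb.1, hab⟩
  · rintro ⟨ha, hb, hab⟩
    refine ⟨ha, ⟨hb, ?_⟩, hab⟩
    rintro rfl
    exact h a ha hab

/-- Deleting one more vertex `x` lowers the total degree of `B` by the number of neighbours of
`x` in `B`. -/
theorem finsum_degDel_insert [Finite V] (G : SimpleGraph V) {A B : Set V} {x : V} (hx : x ∉ A) :
    ∑ᶠ v ∈ B, degDel G A v =
      (∑ᶠ v ∈ B, degDel G (insert x A) v) + (G.neighborSet x ∩ B).ncard := by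
  have key : ∀ v, degDel G A v = degDel G (insert x A) v + (G.neighborSet v ∩ {x}).ncard := by
    intro v
    rw [degDel, degDel, ← Set.ncard_union_eq _ (Set.toFinite _) (Set.toFinite _)]
    · congr 1
      ext w
      simp only [Set.mem_sdiff, Set.mem_union, Set.mem_inter_iff, Set.mem_insert_iff,
        Set.mem_singleton_iff]
      constructor
      · tauto
      · rintro (h | ⟨h, rfl⟩)
        · tauto
        · exact ⟨h, hx⟩
    · rw [Set.disjoint_left]
      rintro w hw ⟨-, rfl⟩
      exact hw.2 (Set.mem_insert _ _)
  have hsum : (G.neighborSet x ∩ B).ncard = ∑ᶠ v ∈ B, (G.neighborSet v ∩ {x}).ncard := by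
    rw [← eCnt_eq_finsum, eCnt_comm, eCnt_eq_finsum, finsum_mem_singleton]
  rw [hsum, ← finsum_mem_add_distrib (Set.toFinite _)]
  exact finsum_mem_congr rfl fun v _ => key v

end CountingEdges

section Components

variable {V : Type*} {G : SimpleGraph V} {s t : Set V}

theorem mem_compSupp {c : (G.induce s).ConnectedComponent} {v : V} :
    v ∈ compSupp c ↔ ∃ h : v ∈ s, (G.induce s).connectedComponentMk ⟨v, h⟩ = c := by
  simp [compSupp, SimpleGraph.ConnectedComponent.mem_supp_iff]

theorem compSupp_subset (c : (G.induce s).ConnectedComponent) : compSupp c ⊆ s :=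
  fun _ hv => (mem_compSupp.1 hv).1

theorem eq_of_mem_compSupp {c d : (G.induce s).ConnectedComponent} {v : V}
    (hc : v ∈ compSupp c) (hd : v ∈ compSupp d) : c = d := by
  obtain ⟨h, rfl⟩ := mem_compSupp.1 hc
  obtain ⟨h', rfl⟩ := mem_compSupp.1 hd
  rfl

theorem compSupp_nonempty (c : (G.induce s).ConnectedComponent) : (compSupp c).Nonempty :=
  c.nonempty_supp.image _

theorem compSupp_injective :
    Function.Injective (compSupp : (G.induce s).ConnectedComponent → Set V) := by
  intro c d h
  obtain ⟨v, hv⟩ := compSupp_nonempty c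
  exact eq_of_mem_compSupp hv (h ▸ hv)

theorem iUnion_compSupp : ⋃ c : (G.induce s).ConnectedComponent, compSupp c = s := by
  ext v
  simp [mem_compSupp]

theorem mem_compSupp_of_adj {c : (G.induce s).ConnectedComponent} {u w : V}
    (hu : u ∈ compSupp c) (hw : w ∈ s) (h : G.Adj u w) : w ∈ compSupp c := by
  obtain ⟨hus, rfl⟩ := mem_compSupp.1 hu
  refine mem_compSupp.2 ⟨hw, SimpleGraph.ConnectedComponent.sound ?_⟩
  exact SimpleGraph.Adj.reachable (G := G.induce s) h.symm

/-- A component of `G[s]` that lies in `t` and sends no edges to `t \ s` is a component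
of `G[t]`. -/
theorem exists_compSupp_eq (c : (G.induce s).ConnectedComponent) (hct : compSupp c ⊆ t)
    (hcl : ∀ u ∈ compSupp c, ∀ w ∈ t, G.Adj u w → w ∈ s) :
    ∃ d : (G.induce t).ConnectedComponent, compSupp d = compSupp c := by
  obtain ⟨u, hu⟩ := compSupp_nonempty c
  refine ⟨(G.induce t).connectedComponentMk ⟨u, hct hu⟩, ?_⟩
  ext v
  constructor
  · intro hv
    obtain ⟨hvt, hv⟩ := mem_compSupp.1 hv
    have hr := (SimpleGraph.ConnectedComponent.exact hv).symm
    rw [SimpleGraph.reachable_iff_reflTransGen] at hr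
    suffices ∀ w : t, Relation.ReflTransGen (G.induce t).Adj ⟨u, hct hu⟩ w →
        w.1 ∈ compSupp c from this _ hr
    intro w hw
    induction hw with
    | refl => exact hu
    | tail _ hab ih => exact mem_compSupp_of_adj ih (hcl _ ih _ (Subtype.prop _) hab) hab
  · intro hv
    obtain ⟨hvs, hv'⟩ := mem_compSupp.1 hv
    obtain ⟨hus, hu'⟩ := mem_compSupp.1 hu
    have hr := SimpleGraph.ConnectedComponent.exact (hu'.trans hv'.symm)
    rw [SimpleGraph.reachable_iff_reflTransGen] at hr
    suffices ∀ w : s, Relation.ReflTransGen (G.induce s).Adj ⟨u, hus⟩ w →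
        w.1 ∈ compSupp c ∧
          w.1 ∈ compSupp ((G.induce t).connectedComponentMk ⟨u, hct hu⟩) from (this _ hr).2
    intro w hw
    induction hw with
    | refl => exact ⟨hu, mem_compSupp.2 ⟨hct hu, rfl⟩⟩
    | tail _ hab ih =>
      have h := mem_compSupp_of_adj ih.1 (Subtype.prop _) hab
      exact ⟨h, mem_compSupp_of_adj ih.2 (hct h) hab⟩

end Components

section OddComponents

variable {V : Type*}

/-- The vertex sets of the odd components of `G − (A ∪ B)`. -/
def oddCompSupps (G : SimpleGraph V) (f : V → ℤ) (A B : Set V) : Set (Set V) :=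
  {C | ∃ c : (G.induce (A ∪ B)ᶜ).ConnectedComponent, compSupp c = C ∧ IsOddComp G f A B c}

theorem hWnum_eq_ncard (G : SimpleGraph V) {W : Set V} {g f : V → ℤ}
    (hgf : ∀ v ∉ W, g v = f v) (A B : Set V) :
    hWnum G W g f A B = (oddCompSupps G f A B).ncard := by
  have h : oddCompSupps G f A B = compSupp ''
      {c : (G.induce (A ∪ B)ᶜ).ConnectedComponent |
        (∀ v ∈ compSupp c \ W, g v = f v) ∧ IsOddComp G f A B c} := by
    ext C
    constructor
    · rintro ⟨c, hc, ho⟩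
      exact ⟨c, ⟨fun v hv => hgf v hv.2, ho⟩, hc⟩
    · rintro ⟨c, ⟨-, ho⟩, hc⟩
      exact ⟨c, hc, ho⟩
  rw [h, Set.ncard_image_of_injective _ compSupp_injective]
  rfl

/-- Taking a vertex out of `B` destroys at most `d_{G−A}(v)` odd components. -/
theorem ncard_oddCompSupps_le_sdiff_right [Finite V] (G : SimpleGraph V) (f : V → ℤ)
    (A B : Set V) (v : V) :
    (oddCompSupps G f A B).ncard ≤
      (oddCompSupps G f A (B \ {v})).ncard + degDel G A v := by
  have hadj : ∀ C ∈ oddCompSupps G f A B \ oddCompSupps G f A (B \ {v}),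
      ∃ u ∈ C, G.Adj u v := by
    rintro _ ⟨⟨c, rfl, hc⟩, hC⟩
    by_contra! hno
    obtain ⟨d, hd⟩ := exists_compSupp_eq (t := (A ∪ B \ {v})ᶜ) c
      (fun w hw => by have := compSupp_subset c hw; simp at this ⊢; tauto)
      (fun u hu w hw huw => by
        have : w ≠ v := by rintro rfl; exact hno u hu huw
        simp at hw ⊢; tauto)
    refine hC ⟨d, hd, ?_⟩
    rw [IsOddComp, hd, eCnt_sdiff_singleton_right G hno]
    exact hc
  have hle : (oddCompSupps G f A B \ oddCompSupps G f A (B \ {v})).ncard ≤ degDel G A v := by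
    have : Nonempty V := ⟨v⟩
    choose! u hu huv using hadj
    refine Set.ncard_le_ncard_of_injOn u ?_ ?_ (Set.toFinite _)
    · intro C hC
      refine ⟨(huv C hC).symm, ?_⟩
      obtain ⟨⟨c, rfl, -⟩, -⟩ := id hC
      have := compSupp_subset c (hu _ hC)
      simp at this
      exact this.1
    · intro C hC C' hC' h
      obtain ⟨⟨c, rfl, -⟩, -⟩ := id hC
      obtain ⟨⟨c', rfl, -⟩, -⟩ := id hC'
      have h1 := hu _ hC
      rw [h] at h1
      rw [eq_of_mem_compSupp h1 (hu _ hC')]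
  have := Set.ncard_le_ncard_sdiff_add_ncard (oddCompSupps G f A B)
    (oddCompSupps G f A (B \ {v})) (Set.toFinite _)
  omega

/-- Moving a vertex of `G − (A ∪ B)` to `A` destroys at most one odd component. -/
theorem ncard_oddCompSupps_le_insert_left [Finite V] (G : SimpleGraph V) (f : V → ℤ)
    {A B : Set V} (c : (G.induce (A ∪ B)ᶜ).ConnectedComponent) {x : V} (hx : x ∈ compSupp c) :
    (oddCompSupps G f A B).ncard ≤ (oddCompSupps G f (insert x A) B).ncard + 1 := by
  have hsub : oddCompSupps G f A B ⊆ insert (compSupp c) (oddCompSupps G f (insert x A) B) := by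
    rintro _ ⟨d, rfl, hd⟩
    rw [Set.mem_insert_iff, or_iff_not_imp_left]
    intro hne
    obtain ⟨d', hd'⟩ := exists_compSupp_eq (t := (insert x A ∪ B)ᶜ) d
      (fun w hw => by
        have hwx : w ≠ x := by
          rintro rfl
          exact hne (by rw [eq_of_mem_compSupp hw hx])
        have := compSupp_subset d hw
        simp at this ⊢; tauto)
      (fun u _ w hw _ => by simp at hw ⊢; tauto)
    refine ⟨d', hd', ?_⟩
    rw [IsOddComp, hd']
    exact hd
  exact (Set.ncard_le_ncard hsub (Set.toFinite _)).trans (Set.ncard_insert_le _ _)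

/-- The number of odd components has the parity of the total weight of `G − (A ∪ B)`. -/
theorem natCast_hWnum_modEq [Finite V] (G : SimpleGraph V) {W : Set V} {g f : V → ℤ}
    (hgf : ∀ v ∉ W, g v = f v) (A B : Set V) :
    (hWnum G W g f A B : ℤ) ≡
      (∑ᶠ v ∈ (A ∪ B)ᶜ, f v) + (eCnt G (A ∪ B)ᶜ B : ℤ) [ZMOD 2] := by
  classical
  have := Fintype.ofFinite (G.induce (A ∪ B)ᶜ).ConnectedComponent
  have hweight : ∀ S : Set V, (∑ᶠ v ∈ S, f v) + (eCnt G S B : ℤ) =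
      ∑ᶠ v ∈ S, (f v + ((G.neighborSet v ∩ B).ncard : ℤ)) := by
    intro S
    rw [finsum_mem_add_distrib (Set.toFinite _), eCnt_eq_finsum,
      ← Nat.cast_finsum_mem (Set.toFinite _)]
  have hsum : (∑ᶠ v ∈ (A ∪ B)ᶜ, f v) + (eCnt G (A ∪ B)ᶜ B : ℤ) =
      ∑ c : (G.induce (A ∪ B)ᶜ).ConnectedComponent,
        ((∑ᶠ v ∈ compSupp c, f v) + (eCnt G (compSupp c) B : ℤ)) := by
    simp_rw [hweight]
    rw [← finsum_eq_sum_of_fintype, ← finsum_mem_iUnion, iUnion_compSupp]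
    · intro c d hcd
      exact Set.disjoint_left.2 fun v hc hd => hcd (eq_of_mem_compSupp hc hd)
    · exact fun c => Set.toFinite _
  have hcount : (hWnum G W g f A B : ℤ) =
      ∑ c : (G.induce (A ∪ B)ᶜ).ConnectedComponent, if IsOddComp G f A B c then 1 else 0 := by
    have h : ∀ c : (G.induce (A ∪ B)ᶜ).ConnectedComponent,
        (∀ v ∈ compSupp c \ W, g v = f v) ∧ IsOddComp G f A B c ↔ IsOddComp G f A B c :=
      fun c => and_iff_right fun v hv => hgf v hv.2
    rw [hWnum, Nat.card_congr (Equiv.subtypeEquivRight h), Nat.card_eq_fintype_card,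
      Fintype.card_subtype]
    simp
  rw [hsum, hcount]
  refine Int.ModEq.sum fun c _ => ?_
  split_ifs with h
  · obtain ⟨m, hm⟩ := h
    rw [hm, Int.ModEq]
    omega
  · obtain ⟨m, hm⟩ := Int.not_odd_iff_even.1 h
    rw [hm, Int.ModEq]
    omega

/-- If `f ≡ g (mod 2)`, `B` is independent and `f` has even total, then `δ_G(A,B)` is even. -/
theorem even_deltaG [Finite V] (G : SimpleGraph V) {W : Set V} {g f : V → ℤ}
    (hgf : ∀ v ∉ W, g v = f v) (hmod : ∀ v, g v ≡ f v [ZMOD 2]) (hf : Even (∑ᶠ v, f v))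
    {A B : Set V} (hAB : Disjoint A B) (hB : ∀ u ∈ B, ∀ v ∈ B, ¬ G.Adj u v) :
    Even (deltaG G W g f A B) := by
  have hh := natCast_hWnum_modEq G hgf A B
  have htot : ∑ᶠ v, f v = (∑ᶠ v ∈ A, f v) + (∑ᶠ v ∈ B, f v) + ∑ᶠ v ∈ (A ∪ B)ᶜ, f v := by
    rw [← finsum_mem_union hAB (Set.toFinite _) (Set.toFinite _),
      ← finsum_mem_union disjoint_compl_right (Set.toFinite _) (Set.toFinite _),
      Set.union_compl_self, finsum_mem_univ]
  have hg : ∑ᶠ v ∈ B, g v ≡ ∑ᶠ v ∈ B, f v [ZMOD 2] := by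
    rw [finsum_mem_eq_finite_toFinset_sum _ (Set.toFinite B),
      finsum_mem_eq_finite_toFinset_sum _ (Set.toFinite B)]
    exact Int.ModEq.sum fun v _ => hmod v
  have hdeg : ∑ᶠ v ∈ B, (degDel G A v : ℤ) = (eCnt G (A ∪ B)ᶜ B : ℤ) := by
    rw [eCnt_comm, eCnt_eq_finsum, Nat.cast_finsum_mem (Set.toFinite _)]
    refine finsum_mem_congr rfl fun v hv => ?_
    rw [degDel]
    congr 2
    ext w
    simp only [Set.mem_sdiff, Set.mem_inter_iff, Set.mem_compl_iff, Set.mem_union]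
    have := hB v hv w
    simp only [SimpleGraph.mem_neighborSet]
    tauto
  rw [deltaG, hdeg]
  obtain ⟨m, hm⟩ := hf
  rw [Int.even_iff]
  rw [Int.ModEq] at hh hg
  omega

end OddComponents

section BiasedBarriers

variable {V : Type*} [Finite V] {G : SimpleGraph V} {W : Set V} {g f : V → ℤ} {A B : Set V}

theorem IsBiasedBarrier.pos_of_mem (hAB : IsBiasedBarrier G W g f A B)
    (hgf : ∀ v ∉ W, g v = f v) {v : V} (hv : v ∈ B) : 0 < g v := by
  obtain ⟨⟨hdisj, hneg⟩, hmin, hcard, -⟩ := hAB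
  by_contra! hg
  have hh := ncard_oddCompSupps_le_sdiff_right G f A B v
  rw [← hWnum_eq_ncard G hgf, ← hWnum_eq_ncard G hgf] at hh
  have hsplit : ∀ φ : V → ℤ, ∑ᶠ u ∈ B, φ u = φ v + ∑ᶠ u ∈ B \ {v}, φ u := by
    intro φ
    rw [← finsum_mem_insert _ (by simp) (Set.toFinite _), Set.insert_sdiff_singleton,
      Set.insert_eq_of_mem hv]
  have hle : deltaG G W g f A (B \ {v}) ≤ deltaG G W g f A B := by
    rw [deltaG, deltaG, hsplit g, hsplit fun u => (degDel G A u : ℤ)]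
    zify at hh
    linarith
  have hbar : IsBarrier G W g f A (B \ {v}) :=
    ⟨hdisj.mono_right Set.sdiff_subset, hle.trans_lt hneg⟩
  exact (hcard _ _ hbar (le_antisymm hle (hmin _ _ hbar))).not_gt
    (Set.ncard_sdiff_singleton_lt_of_mem hv (Set.toFinite _))

theorem IsBiasedBarrier.ncard_neighborSet_inter_lt (hAB : IsBiasedBarrier G W g f A B)
    (hgf : ∀ v ∉ W, g v = f v) (hmod : ∀ v, g v ≡ f v [ZMOD 2]) (hf : Even (∑ᶠ v, f v))
    (hB : ∀ u ∈ B, ∀ v ∈ B, ¬ G.Adj u v) (c : (G.induce (A ∪ B)ᶜ).ConnectedComponent) {x : V}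
    (hx : x ∈ compSupp c) : ((G.neighborSet x ∩ B).ncard : ℤ) < f x := by
  obtain ⟨⟨hdisj, hneg⟩, hmin, -, hmax⟩ := hAB
  have hxAB := compSupp_subset c hx
  simp only [Set.mem_compl_iff, Set.mem_union, not_or] at hxAB
  obtain ⟨hxA, hxB⟩ := hxAB
  by_contra! hlt
  have hh := ncard_oddCompSupps_le_insert_left G f c hx
  rw [← hWnum_eq_ncard G hgf, ← hWnum_eq_ncard G hgf] at hh
  have hdisj' : Disjoint (insert x A) B := Set.disjoint_insert_left.2 ⟨hxB, hdisj⟩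
  have hdeg := congrArg (Nat.cast : ℕ → ℤ) (finsum_degDel_insert G (B := B) hxA)
  rw [Nat.cast_add, Nat.cast_finsum_mem (Set.toFinite _),
    Nat.cast_finsum_mem (Set.toFinite _)] at hdeg
  have hle : deltaG G W g f (insert x A) B ≤ deltaG G W g f A B + 1 := by
    zify at hh
    rw [deltaG, deltaG, hdeg, finsum_mem_insert _ hxA (Set.toFinite _)]
    linarith
  obtain ⟨a, ha⟩ := even_deltaG G hgf hmod hf hdisj hB
  obtain ⟨b, hb⟩ := even_deltaG G hgf hmod hf hdisj' hB
  have hle' : deltaG G W g f (insert x A) B ≤ deltaG G W g f A B := by omega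
  have hbar : IsBarrier G W g f (insert x A) B := ⟨hdisj', hle'.trans_lt hneg⟩
  have hcard := hmax _ _ hbar (le_antisymm hle' (hmin _ _ hbar)) rfl
  rw [Set.ncard_insert_of_notMem hxA] at hcard
  omega

end BiasedBarriers

/-- for a biased barrier `(A,B)` and an odd component `D` of `G − (A ∪ B)`,
we have `|V(D)| ≥ e_G(B,D)`. -/
theorem biased_barrier_odd_comp_card_ge {X Y : Type*} [Fintype X] [Fintype Y]
    (G : SimpleGraph (X ⊕ Y))
    (hX : ∀ x x' : X, ¬ G.Adj (Sum.inl x) (Sum.inl x'))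
    (hY : ∀ y y' : Y, ¬ G.Adj (Sum.inr y) (Sum.inr y'))
    (k : ℕ) (hk : 1 ≤ k) (heven : Even (k * Fintype.card Y))
    (hno : ¬ ∃ F : SimpleGraph (X ⊕ Y),
      IsPPFactor G F (Set.range (Sum.inl : X → X ⊕ Y)) (gB X Y k) (fB X Y k))
    (A B : Set (X ⊕ Y))
    (hAB : IsBiasedBarrier G (Set.range (Sum.inl : X → X ⊕ Y)) (gB X Y k) (fB X Y k) A B)
    (c : (G.induce (A ∪ B)ᶜ).ConnectedComponent)
    (hodd : IsOddComp G (fB X Y k) A B c) :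
    eCnt G B (compSupp c) ≤ (compSupp c).ncard := by
  have hgf : ∀ v ∉ Set.range (Sum.inl : X → X ⊕ Y), gB X Y k v = fB X Y k v := by
    rintro (x | y) hv
    · exact absurd ⟨x, rfl⟩ hv
    · rfl
  have hmod : ∀ v, gB X Y k v ≡ fB X Y k v [ZMOD 2] := by
    rintro (x | y) <;> simp [gB, fB, Int.ModEq]
  have hf : Even (∑ᶠ v, fB X Y k v) := by
    rw [finsum_eq_sum_of_fintype, Fintype.sum_sum_type]
    simp only [fB, Sum.elim_inl, Sum.elim_inr, Finset.sum_const, Finset.card_univ, nsmul_eq_mul]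
    refine (even_two.mul_left _).add ?_
    rw [mul_comm]
    exact_mod_cast heven
  have hBY : ∀ v ∈ B, ∃ y, v = Sum.inr y := by
    rintro (x | y) hv
    · exact absurd (hAB.pos_of_mem hgf hv) (by simp [gB])
    · exact ⟨y, rfl⟩
  have hB : ∀ u ∈ B, ∀ v ∈ B, ¬ G.Adj u v := by
    intro u hu v hv
    obtain ⟨y, rfl⟩ := hBY u hu
    obtain ⟨y', rfl⟩ := hBY v hv
    exact hY y y'
  have hone : ∀ v ∈ compSupp c, (G.neighborSet v ∩ B).ncard ≤ 1 := by
    rintro (x | y) hv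
    · have := hAB.ncard_neighborSet_inter_lt hgf hmod hf hB c hv
      simp only [fB, Sum.elim_inl] at this
      omega
    · have : G.neighborSet (Sum.inr y) ∩ B = ∅ := by
        rw [Set.eq_empty_iff_forall_notMem]
        rintro w ⟨hw, hwB⟩
        obtain ⟨y', rfl⟩ := hBY w hwB
        exact hY y y' hw
      simp [this]
  rw [eCnt_comm, eCnt_eq_finsum, finsum_mem_eq_finite_toFinset_sum _ (Set.toFinite _),
    Set.ncard_eq_toFinset_card _ (Set.toFinite _)]
  refine (Finset.sum_le_card_nsmul _ _ 1 fun v hv => hone v ?_).trans_eq (by simp)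
  simpa using hv
end
end

section
/- Let G[X,Y] be a finite bipartite graph with parts X and Y having no isolated vertices from X. If G has no Y-cutset, then for any two distinct vertices u, v ∈ Y there exists a vertex x ∈ X whose neighborhood in G is exactly {u, v}. -/
noncomputable section

/-- The number of connected components of the strong deletion `G ⊖ S`, the induced subgraph
of `G` on the complement of `S ∪ N_G(S)`. -/
def cStrong {V : Type*} (G : SimpleGraph V) (S : Set V) : ℕ :=
  Nat.card (G.induce ((S ∪ ⋃ v ∈ S, G.neighborSet v)ᶜ)).ConnectedComponent

/-- A predicate preserved along edges is preserved along reachability. -/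
theorem SimpleGraph.Reachable.of_adj_closed {V : Type*} {G : SimpleGraph V} {P : V → Prop}
    (hP : ∀ a b, G.Adj a b → P a → P b) {a b : V} (h : G.Reachable a b) (ha : P a) : P b := by
  obtain ⟨p⟩ := h
  induction p with
  | nil => exact ha
  | cons hadj _ ih => exact ih (hP _ _ hadj ha)

/-- Two vertices surviving a strong deletion with fewer than two components are reachable
from one another. -/
theorem reachable_of_cStrong_lt_two {V : Type*} [Finite V] {G : SimpleGraph V} {S : Set V}
    (h : cStrong G S < 2) (a b : ↥((S ∪ ⋃ v ∈ S, G.neighborSet v)ᶜ)) :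
    (G.induce ((S ∪ ⋃ v ∈ S, G.neighborSet v)ᶜ)).Reachable a b := by
  have := Finite.card_le_one_iff_subsingleton.mp (Nat.lt_succ_iff.mp h)
  exact SimpleGraph.ConnectedComponent.exact (Subsingleton.elim _ _)

/-- if `G[X,Y]` has no isolated vertices in `X` and no `Y`-cutset, then for
any two distinct `u, v ∈ Y` some `x ∈ X` has neighborhood exactly `{u, v}`. -/
theorem no_cutset_pair_edge {X Y : Type*} [Fintype X] [Fintype Y] (G : SimpleGraph (X ⊕ Y))
    (hX : ∀ x x' : X, ¬ G.Adj (Sum.inl x) (Sum.inl x'))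
    (hY : ∀ y y' : Y, ¬ G.Adj (Sum.inr y) (Sum.inr y'))
    (hiso : ∀ x : X, ∃ w, G.Adj (Sum.inl x) w)
    (hnocut : ∀ S : Set (X ⊕ Y), S ⊆ Set.range Sum.inr → cStrong G S < 2)
    (u v : Y) (huv : u ≠ v) :
    ∃ x : X, G.neighborSet (Sum.inl x) = {Sum.inr u, Sum.inr v} := by
  let S : Set (X ⊕ Y) := Sum.inr '' {y | y ≠ u ∧ y ≠ v}
  have mem_compl : ∀ y : Y, (y = u ∨ y = v) →
      Sum.inr y ∈ ((S ∪ ⋃ w ∈ S, G.neighborSet w)ᶜ : Set (X ⊕ Y)) := by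
    rintro y hy (⟨z, hz, hzy⟩ | h)
    · obtain rfl := Sum.inr_injective hzy
      exact hy.elim hz.1 hz.2
    · simp only [Set.mem_iUnion] at h
      obtain ⟨_, ⟨z, -, rfl⟩, h⟩ := h
      exact hY _ _ h
  have hreach := reachable_of_cStrong_lt_two (hnocut S (Set.image_subset_range _ _))
    ⟨_, mem_compl u (.inl rfl)⟩ ⟨_, mem_compl v (.inr rfl)⟩
  by_contra! hne
  have key := hreach.of_adj_closed
    (P := fun w => w.1 = Sum.inr u ∨ G.Adj (Sum.inr u) w.1) ?_ (.inl rfl)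
  · rcases key with h | h
    · exact huv (Sum.inr_injective h).symm
    · exact hY _ _ h
  rintro ⟨a, ha⟩ ⟨b, hb⟩ hab h
  replace hab : G.Adj a b := hab
  rcases h with rfl | h
  · exact .inr hab
  rcases a with x | y
  swap
  · exact (hY _ _ h).elim
  rcases b with x' | y
  · exact (hX _ _ hab).elim
  by_cases hyu : y = u
  · exact .inl (congrArg _ hyu)
  have hbS : ∀ z : Y, G.Adj (Sum.inl x) (Sum.inr z) → z = u ∨ z = v := by
    intro z hz
    by_contra! hzuv
    exact ha (.inr (Set.mem_biUnion (Set.mem_image_of_mem _ hzuv) hz.symm))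
  obtain rfl : y = v := (hbS y hab).resolve_left hyu
  refine (hne x (Set.ext fun w => ?_)).elim
  rcases w with x' | z
  · simpa using hX x x'
  · simp only [SimpleGraph.mem_neighborSet, Set.mem_insert_iff, Set.mem_singleton_iff,
      Sum.inr.injEq]
    refine ⟨hbS z, ?_⟩
    rintro (rfl | rfl)
    · exact h.symm
    · exact hab
end
end

section
/- Let H be a finite hypergraph in which every edge is nonempty, let I(H) be its incidence bipartite graph with parts X = E(H) and Y = V(H), and let t ≥ 0 be a real number. Then H is t-tough if and only if |S| ≥ t·c(I(H)⊖S) for every S ⊆ Y with c(I(H)⊖S) ≥ 2; consequently, the toughness of H equals the Y-toughness of I(H). -/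
noncomputable section

/-- The skeleton graph of the hypergraph `(V, E)` after deleting the vertices of `S` and all
edges meeting `S`: two remaining vertices are adjacent iff some surviving edge contains both.
Two vertices of `H − S` are in the same component (i.e. joined by a Berge-path) iff they are
connected in this graph. -/
def hypDel {V : Type*} (E : Finset (Finset V)) (S : Set V) : SimpleGraph ↥(Sᶜ) :=
  SimpleGraph.fromRel (fun u v =>
    ∃ e ∈ E, (∀ w ∈ e, w ∉ S) ∧ (u : V) ∈ e ∧ (v : V) ∈ e)

/-- The number of components of `H − S`. -/
def cHyp {V : Type*} (E : Finset (Finset V)) (S : Set V) : ℕ :=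
  Nat.card (hypDel E S).ConnectedComponent

/-- The incidence bipartite graph of the hypergraph `(V, E)`: parts `E` and `V`, with
`e` adjacent to `v` exactly when `v ∈ e`. -/
def incG {V : Type*} (E : Finset (Finset V)) : SimpleGraph (↥E ⊕ V) :=
  SimpleGraph.fromRel (fun a b =>
    ∃ (e : ↥E) (v : V), v ∈ (e : Finset V) ∧ a = Sum.inl e ∧ b = Sum.inr v)

/-- A vertex map sending adjacent vertices to connected vertices preserves reachability. -/
theorem SimpleGraph.Reachable.map_of_adj {A B : Type*} {G : SimpleGraph A} {H : SimpleGraph B}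
    {f : A → B} (hf : ∀ a b, G.Adj a b → H.Reachable (f a) (f b)) {a b : A}
    (h : G.Reachable a b) : H.Reachable (f a) (f b) := by
  obtain ⟨p⟩ := h
  induction p with
  | nil => exact SimpleGraph.Reachable.refl _
  | cons hadj _ ih => exact (hf _ _ hadj).trans ih

/-- Two vertex maps that preserve reachability and are mutually inverse up to reachability
identify the connected components of the two graphs. -/
theorem SimpleGraph.card_connectedComponent_eq {A B : Type*} {G : SimpleGraph A}
    {H : SimpleGraph B} (f : A → B) (g : B → A)
    (hf : ∀ a b, G.Adj a b → H.Reachable (f a) (f b))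
    (hg : ∀ a b, H.Adj a b → G.Reachable (g a) (g b))
    (hgf : ∀ a, G.Reachable (g (f a)) a) (hfg : ∀ b, H.Reachable (f (g b)) b) :
    Nat.card G.ConnectedComponent = Nat.card H.ConnectedComponent :=
  Nat.card_congr
    { toFun := Quot.map f fun _ _ h => h.map_of_adj hf
      invFun := Quot.map g fun _ _ h => h.map_of_adj hg
      left_inv := by
        rintro ⟨a⟩
        exact Quot.sound (hgf a)
      right_inv := by
        rintro ⟨b⟩
        exact Quot.sound (hfg b) }

theorem incG_adj_inl_inr {V : Type*} {E : Finset (Finset V)} {e : ↥E} {v : V} :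
    (incG E).Adj (Sum.inl e) (Sum.inr v) ↔ v ∈ (e : Finset V) := by
  simp [incG, SimpleGraph.fromRel_adj]

theorem incG_adj_inr_inl {V : Type*} {E : Finset (Finset V)} {e : ↥E} {v : V} :
    (incG E).Adj (Sum.inr v) (Sum.inl e) ↔ v ∈ (e : Finset V) :=
  (SimpleGraph.adj_comm _ _ _).trans incG_adj_inl_inr

theorem incG_not_adj_inl_inl {V : Type*} {E : Finset (Finset V)} {e e' : ↥E} :
    ¬ (incG E).Adj (Sum.inl e) (Sum.inl e') := by
  simp [incG, SimpleGraph.fromRel_adj]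

theorem incG_not_adj_inr_inr {V : Type*} {E : Finset (Finset V)} {u v : V} :
    ¬ (incG E).Adj (Sum.inr u) (Sum.inr v) := by
  simp [incG, SimpleGraph.fromRel_adj]

/-- A vertex of the hypergraph survives the strong deletion iff it is not deleted. -/
theorem inr_mem_strongDel {V : Type*} {E : Finset (Finset V)} {S : Set V} {v : V} :
    Sum.inr v ∈ (Sum.inr '' S ∪ ⋃ w ∈ Sum.inr '' S, (incG E).neighborSet w)ᶜ ↔ v ∉ S := by
  simp [incG_not_adj_inr_inr]

/-- An edge of the hypergraph survives the strong deletion iff it is disjoint from `S`. -/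
theorem inl_mem_strongDel {V : Type*} {E : Finset (Finset V)} {S : Set V} {e : ↥E} :
    Sum.inl e ∈ (Sum.inr '' S ∪ ⋃ w ∈ Sum.inr '' S, (incG E).neighborSet w)ᶜ ↔
      ∀ w ∈ (e : Finset V), w ∉ S := by
  simp [incG_adj_inr_inl, imp_not_comm]

/-- Two vertices on a common surviving edge are connected in `H − S`. -/
theorem hypDel_reachable {V : Type*} {E : Finset (Finset V)} {S : Set V} {e : Finset V}
    (he : e ∈ E) (heS : ∀ w ∈ e, w ∉ S) {u v : ↥(Sᶜ)} (hu : (u : V) ∈ e) (hv : (v : V) ∈ e) :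
    (hypDel E S).Reachable u v := by
  by_cases h : u = v
  · exact h ▸ SimpleGraph.Reachable.refl _
  · exact SimpleGraph.Adj.reachable ⟨h, Or.inl ⟨e, he, heS, hu, hv⟩⟩

theorem cHyp_eq_cStrong {V : Type*} (E : Finset (Finset V)) (hne : ∀ e ∈ E, e.Nonempty)
    (S : Set V) : cHyp E S = cStrong (incG E) (Sum.inr '' S) := by
  have hrep : ∀ a : ↥((Sum.inr '' S ∪ ⋃ w ∈ Sum.inr '' S, (incG E).neighborSet w)ᶜ),
      ∃ u : ↥(Sᶜ), a.1 = Sum.inr u.1 ∨ ∃ e : ↥E, a.1 = Sum.inl e ∧ u.1 ∈ e.1 := by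
    rintro ⟨e | v, ha⟩
    · obtain ⟨u, hu⟩ := hne e.1 e.2
      exact ⟨⟨u, inl_mem_strongDel.1 ha u hu⟩, Or.inr ⟨e, rfl, hu⟩⟩
    · exact ⟨⟨v, inr_mem_strongDel.1 ha⟩, Or.inl rfl⟩
  choose g hg using hrep
  have hg_inr : ∀ v hv, g ⟨Sum.inr v, hv⟩ = ⟨v, inr_mem_strongDel.1 hv⟩ := by
    intro v hv
    rcases hg ⟨Sum.inr v, hv⟩ with h | ⟨e, h, -⟩
    · exact Subtype.ext (Sum.inr_injective h).symm
    · cases h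
  have hg_inl : ∀ e he, (g ⟨Sum.inl e, he⟩).1 ∈ e.1 := by
    intro e he
    rcases hg ⟨Sum.inl e, he⟩ with h | ⟨e', h, hu⟩
    · cases h
    · cases h
      exact hu
  refine SimpleGraph.card_connectedComponent_eq
    (fun u => ⟨Sum.inr u.1, inr_mem_strongDel.2 u.2⟩) g ?_ ?_ ?_ ?_
  · have key : ∀ (e : ↥E) (heS : ∀ w ∈ e.1, w ∉ S) (u v : ↥(Sᶜ)), u.1 ∈ e.1 → v.1 ∈ e.1 →
        ((incG E).induce
          ((Sum.inr '' S ∪ ⋃ w ∈ Sum.inr '' S, (incG E).neighborSet w)ᶜ)).Reachable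
          ⟨Sum.inr u.1, inr_mem_strongDel.2 u.2⟩ ⟨Sum.inr v.1, inr_mem_strongDel.2 v.2⟩ := by
      intro e heS u v hu hv
      have hadj : ∀ w : ↥(Sᶜ), w.1 ∈ e.1 → ((incG E).induce
          ((Sum.inr '' S ∪ ⋃ w ∈ Sum.inr '' S, (incG E).neighborSet w)ᶜ)).Adj
          ⟨Sum.inl e, inl_mem_strongDel.2 heS⟩ ⟨Sum.inr w.1, inr_mem_strongDel.2 w.2⟩ :=
        fun w hw => incG_adj_inl_inr.2 hw
      exact (hadj u hu).symm.reachable.trans (hadj v hv).reachable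
    rintro u v ⟨-, ⟨e, he, heS, hu, hv⟩ | ⟨e, he, heS, hv, hu⟩⟩ <;>
      exact key ⟨e, he⟩ heS u v hu hv
  · rintro ⟨e | u, ha⟩ ⟨e' | v, hb⟩ hab
    · exact absurd hab incG_not_adj_inl_inl
    · rw [hg_inr]
      exact hypDel_reachable e.2 (inl_mem_strongDel.1 ha) (hg_inl e ha) (incG_adj_inl_inr.1 hab)
    · rw [hg_inr]
      exact hypDel_reachable e'.2 (inl_mem_strongDel.1 hb) (incG_adj_inr_inl.1 hab)
        (hg_inl e' hb)
    · exact absurd hab incG_not_adj_inr_inr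
  · intro u
    simp only [hg_inr]
    exact SimpleGraph.Reachable.refl _
  · rintro ⟨e | v, hb⟩
    · refine SimpleGraph.Adj.reachable ?_
      exact incG_adj_inr_inl.2 (hg_inl e hb)
    · simp only [hg_inr]
      exact SimpleGraph.Reachable.refl _

/-- for a hypergraph `H` with nonempty edges, `H` is `t`-tough iff
`|S| ≥ t·c(I(H) ⊖ S)` for every `S ⊆ Y = V(H)` with `c(I(H) ⊖ S) ≥ 2`; consequently the
toughness of `H` equals the `Y`-toughness of `I(H)` (both taken as infima, `∞ = ⊤` when no
cutset exists). -/
theorem hypergraph_toughness_eq_Y_toughness {V : Type*} [Fintype V] (E : Finset (Finset V))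
    (hne : ∀ e ∈ E, e.Nonempty) (t : ℝ) (ht : 0 ≤ t) :
    ((∀ S : Set V, 2 ≤ cHyp E S → t * (cHyp E S : ℝ) ≤ (S.ncard : ℝ)) ↔
      (∀ S : Set (↥E ⊕ V), S ⊆ Set.range Sum.inr → 2 ≤ cStrong (incG E) S →
        t * (cStrong (incG E) S : ℝ) ≤ (S.ncard : ℝ))) ∧
    (⨅ S : {S : Set V // 2 ≤ cHyp E S},
        (S.1.ncard : ENNReal) / (cHyp E S.1 : ENNReal)) =
      (⨅ S : {S : Set (↥E ⊕ V) //
          S ⊆ Set.range Sum.inr ∧ 2 ≤ cStrong (incG E) S},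
        (S.1.ncard : ENNReal) / (cStrong (incG E) S.1 : ENNReal)) := by
  have hncard (S : Set V) : ((Sum.inr '' S : Set (↥E ⊕ V))).ncard = S.ncard :=
    Set.ncard_image_of_injective S Sum.inr_injective
  refine ⟨⟨fun h S hS hc => ?_, fun h S hc => ?_⟩, le_antisymm (le_iInf ?_) (le_iInf ?_)⟩
  · obtain ⟨S, rfl⟩ := Set.subset_range_iff_exists_image_eq.1 hS
    rw [← cHyp_eq_cStrong E hne] at hc ⊢
    exact hncard S ▸ h S hc
  · have := h (Sum.inr '' S) (Set.image_subset_range _ _) (cHyp_eq_cStrong E hne S ▸ hc)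
    rwa [← cHyp_eq_cStrong E hne, hncard] at this
  · rintro ⟨S, hS, hc⟩
    obtain ⟨S, rfl⟩ := Set.subset_range_iff_exists_image_eq.1 hS
    rw [← cHyp_eq_cStrong E hne] at hc
    refine (iInf_le _ ⟨S, hc⟩).trans_eq ?_
    simp only [hncard, cHyp_eq_cStrong E hne]
  · rintro ⟨S, hc⟩
    refine (iInf_le _ ⟨Sum.inr '' S, Set.image_subset_range _ _,
      cHyp_eq_cStrong E hne S ▸ hc⟩).trans_eq ?_
    simp only [hncard, cHyp_eq_cStrong E hne]
end
end
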